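/- arXiv:cs/0608124 — 2 statements merged into one kernel-verified Lean document; each statement's English description precedes it below -/
import Mathlib

section
/- For any deep sets of nodes X_1,…,X_k of a tree T with k > 2: (x_1,x_k) ∈ mop(X_1,…,X_k) if and only if there exists a node x_{k-1} such that (x_1,x_{k-1}) ∈ mop(X_1,…,X_{k-1}) and (x_{k-1},x_k) ∈ mop(mop(X_1,…,X_{k-1})|_2, X_k). -/
namespace TreeIncl

/-- Rooted, ordered, labeled trees: a label and an ordered list of children. -/
inductive OTree (α : Type) : Type where
  | node : α → List (OTree α) → OTree α

namespace OTree

variable {α β : Type}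

/-- The label of the root. -/
def label : OTree α → α
  | node a _ => a

/-- The (ordered) children subtrees of the root. -/
def children : OTree α → List (OTree α)
  | node _ cs => cs

/-- Nodes are identified with positions: lists of child indices from the root. -/
abbrev Node : Type := List ℕ

/-- The subtree rooted at a given position, if the position is valid. -/
def sub : Node → OTree α → Option (OTree α)
  | [], t => some t
  | i :: p, t =>
    match t.children[i]? with
    | some c => sub p c
    | none => none

/-- The set `V(T)` of (positions of) nodes of a tree. -/
def Pos (t : OTree α) : Set Node := {p | sub p t ≠ none}

/-- The label of the node at position `p`. -/
def labelAt (t : OTree α) (p : Node) : Option α := (sub p t).map label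

/-- `l_T`: the number of leaves of a tree. -/
def numLeaves : OTree α → ℕ
  | node _ [] => 1
  | node a (c :: cs) => numLeaves c + numLeaves (node a cs)

/-- `n_T`: the number of nodes of a tree. -/
def numNodes : OTree α → ℕ
  | node _ [] => 1
  | node a (c :: cs) => numNodes c + numNodes (node a cs)

/-- The number of leaves of the subtree rooted at position `p` (0 if `p` is invalid). -/
def leavesAt (t : OTree α) (p : Node) : ℕ := ((sub p t).map numLeaves).getD 0

/-- `v ⪯ w` : `v` is an ancestor of `w` (positions: prefix). -/
def Anc (v w : Node) : Prop := v <+: w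

/-- `v ≺ w` : `v` is a proper ancestor of `w` (positions: strict prefix). -/
def SAnc (v w : Node) : Prop := v <+: w ∧ v ≠ w

/-- `u ◁ w` : `u` is to the left of `w`
    (equivalently: `pre(u) < pre(w)` and `post(u) < post(w)`). -/
def LeftOf (u w : Node) : Prop :=
  ∃ (q : Node) (i j : ℕ) (u' w' : Node), i < j ∧ u = q ++ i :: u' ∧ w = q ++ j :: w'

/-- `u ⊴ w` : `u ◁ w` or `u ⪯ w` or `w ≺ u`. -/
def LeftOrAbove (u w : Node) : Prop := LeftOf u w ∨ Anc u w ∨ SAnc w u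

/-- The nearest common ancestor of two positions: longest common prefix. -/
def nca : Node → Node → Node
  | [], _ => []
  | _, [] => []
  | i :: u, j :: w => if i = j then i :: nca u w else []

/-- A set of nodes is deep: no node is a proper ancestor of another node in the set. -/
def DeepSet (X : Set Node) : Prop := ∀ x ∈ X, ∀ y ∈ X, ¬ SAnc x y

/-- `Deep(X)`: the elements of `X` having no proper descendant in `X`. -/
def DeepOf (X : Set Node) : Set Node := {x | x ∈ X ∧ ¬ ∃ z ∈ X, SAnc x z}

/-- `Φ(X_1, …, X_k)`: xs is a tuple with `x_i ∈ X_i` and `x_1 ◁ x_2 ◁ ⋯ ◁ x_k`. -/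
def Phi (Xs : List (Set Node)) (xs : List Node) : Prop :=
  List.Forall₂ (fun x X => x ∈ X) xs Xs ∧ xs.Chain' LeftOf

/-- `mop(X_1, …, X_k)`: the set of minimum ordered pairs. -/
def Mop (Xs : List (Set Node)) : Set (Node × Node) :=
  {p | (∃ xs, Phi Xs xs ∧ xs.head? = some p.1 ∧ xs.getLast? = some p.2) ∧
    ¬ ∃ ys y1 yk, Phi Xs ys ∧ ys.head? = some y1 ∧ ys.getLast? = some yk ∧
      ((LeftOf p.1 y1 ∧ LeftOf y1 yk ∧ LeftOrAbove yk p.2) ∨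
       (LeftOrAbove p.1 y1 ∧ LeftOf y1 yk ∧ LeftOf yk p.2))}

/-- `MopRight(Y, X)`: for `(y₁,y₂) ∈ Y`, `(y₁,x)` is in the result iff
    `(y₂,x) ∈ mop(Y|₂, X)`. -/
def MopRight (Y : Set (Node × Node)) (X : Set Node) : Set (Node × Node) :=
  {r | ∃ y2, (r.1, y2) ∈ Y ∧ (y2, r.2) ∈ Mop [Prod.snd '' Y, X]}

/-- `MopLeft(X, Y)`: for `(y₁,y₂) ∈ Y`, `(x,y₂)` is in the result iff
    `(x,y₁) ∈ mop(X, Y|₁)`. -/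
def MopLeft (X : Set Node) (Y : Set (Node × Node)) : Set (Node × Node) :=
  {r | ∃ y1, (y1, r.2) ∈ Y ∧ (r.1, y1) ∈ Mop [X, Prod.fst '' Y]}

/-- One deletion step: delete a node of the tree, making its children children of its
parent (in its place, in order); the root may be deleted when it has exactly one
child. -/
inductive DelStep : OTree α → OTree α → Prop
  | root (a : α) (t : OTree α) : DelStep (node a [t]) t
  | splice (a b : α) (pre cs post : List (OTree α)) :
      DelStep (node a (pre ++ node b cs :: post)) (node a (pre ++ cs ++ post))
  | congr (a : α) (pre post : List (OTree α)) {t t' : OTree α} :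
      DelStep t t' → DelStep (node a (pre ++ t :: post)) (node a (pre ++ t' :: post))

/-- `P ⊑ T` : `P` can be obtained from `T` by deleting nodes of `T`. -/
def Included (P T : OTree α) : Prop := Relation.ReflTransGen (fun x y => DelStep x y) T P

/-- An embedding of `P` in `T`: an injective map of nodes preserving labels,
    proper ancestorship, and the left-of relation. -/
structure IsEmb (P T : OTree α) (f : Node → Node) : Prop where
  mem : ∀ p ∈ Pos P, f p ∈ Pos T
  inj : ∀ p ∈ Pos P, ∀ q ∈ Pos P, f p = f q → p = q
  lab : ∀ p ∈ Pos P, labelAt T (f p) = labelAt P p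
  anc : ∀ p ∈ Pos P, ∀ q ∈ Pos P, (SAnc p q ↔ SAnc (f p) (f q))
  ord : ∀ p ∈ Pos P, ∀ q ∈ Pos P, (LeftOf p q ↔ LeftOf (f p) (f q))

/-- A deep embedding: no other embedding maps the root of `P` strictly deeper. -/
def IsDeepEmb (P T : OTree α) (f : Node → Node) : Prop :=
  IsEmb P T f ∧ ¬ ∃ g, IsEmb P T g ∧ SAnc (f []) (g [])

/-- `emb(P,T)`: the set of deep occurrences of `P` in `T`. -/
def emb (P T : OTree α) : Set Node := {w | ∃ f, IsDeepEmb P T f ∧ f [] = w}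

/-- `FlAt T x a q` : `q = fl(x, a)`, the first ancestor of `x` labeled `a` in `T`. -/
def FlAt (t : OTree α) (x : Node) (a : α) (q : Node) : Prop :=
  q <+: x ∧ labelAt t q = some a ∧ ∀ r, SAnc q r → r <+: x → labelAt t r ≠ some a

/-! ### Heavy leaf path decompositions -/

/-- `hv` is a heavy leaf path decomposition of `P`: for each internal node (position)
`p`, `hv p` is the index of a child with the maximum number of descendant leaves. -/
def IsHeavyDecomp (P : OTree α) (hv : Node → ℕ) : Prop :=
  ∀ p s, sub p P = some s → s.children ≠ [] →
    ∃ c, s.children[hv p]? = some c ∧ ∀ c' ∈ s.children, numLeaves c' ≤ numLeaves c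

/-- `ldepth(v)`: the number of light edges on the path from the root to `v`. -/
def ldepth (hv : Node → ℕ) (v : Node) : ℕ :=
  (List.range v.length).countP (fun n => v.getD n 0 != hv (v.take n))

/-- The light nodes on the path from the root to `v`, ordered by increasing depth
    (the root is light; a nonroot node is light iff it is not the heavy child
    of its parent). -/
def lightPrefixes (hv : Node → ℕ) (v : Node) : List Node :=
  ((List.range (v.length + 1)).map (fun n => v.take n)).filter
    (fun q => q.getLast? != some (hv q.dropLast))

/-- The position of `heavy(parent(q))` for a nonroot position `q`. -/
def heavySibPos (hv : Node → ℕ) (q : Node) : Node :=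
  q.dropLast ++ [hv q.dropLast]

/-! ### Clusters -/

/-- Two positions are adjacent in the tree (parent/child). -/
def Adj (u v : Node) : Prop := (∃ i, v = u ++ [i]) ∨ (∃ i, u = v ++ [i])

/-- `S` is (the vertex set of) a nonempty connected subgraph of `T`. -/
def Conn (T : OTree α) (S : Set Node) : Prop :=
  S.Nonempty ∧ S ⊆ Pos T ∧
    ∀ u ∈ S, ∀ v ∈ S, ∀ w, nca u v <+: w → (w <+: u ∨ w <+: v) → w ∈ S

/-- The boundary nodes of a connected subgraph `S` of `T`: nodes of `S` adjacent to a
node of `T` outside `S`, together with the root of `T` if it lies in `S`. -/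
def Boundary (T : OTree α) (S : Set Node) : Set Node :=
  {v ∈ S | (∃ u ∈ Pos T, u ∉ S ∧ Adj v u) ∨ v = []}

/-- The edges of `T` joining two nodes of `S`. -/
def EdgesIn (T : OTree α) (S : Set Node) : Set (Node × Node) :=
  {e | e.1 ∈ S ∧ e.2 ∈ S ∧ e.2 ∈ Pos T ∧ ∃ i, e.2 = e.1 ++ [i]}

/-- A cluster of `T`: a connected subgraph with at most two boundary nodes. -/
def IsCluster (T : OTree α) (S : Set Node) : Prop :=
  Conn T S ∧ (Boundary T S).encard ≤ 2

/-- A cluster partition of `T`. -/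
structure IsClusterPartition (T : OTree α) (CS : List (Set Node)) : Prop where
  cluster : ∀ S ∈ CS, IsCluster T S
  coverV : ∀ p ∈ Pos T, ∃ S ∈ CS, p ∈ S
  coverE : ∀ e ∈ EdgesIn T (Pos T), ∃ S ∈ CS, e ∈ EdgesIn T S
  disjE : CS.Pairwise (fun S₁ S₂ => EdgesIn T S₁ ∩ EdgesIn T S₂ = ∅)
  edge : ∀ S ∈ CS, (EdgesIn T S).Nonempty

/-- Binary tree: every node has at most two children. -/
def IsBinary (t : OTree α) : Prop := ∀ p s, sub p t = some s → s.children.length ≤ 2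

/-- Relabeling of a tree. -/
def omap (f : α → β) : OTree α → OTree β
  | node a cs => node (f a) (cs.attach.map (fun c => omap f c.1))
termination_by t => sizeOf t
decreasing_by
  have := List.sizeOf_lt_of_mem c.2
  simp only [OTree.node.sizeOf_spec]
  omega


theorem finite_pos {α : Type} : ∀ t : OTree α, (Pos t).Finite
  | node a cs => by
    have hcs : ∀ c ∈ cs, (Pos c).Finite := fun c _ => finite_pos c
    refine ((Set.finite_singleton []).union
      (Set.finite_iUnion fun i : Fin cs.length =>
        (hcs cs[i] (List.getElem_mem _)).image (List.cons (i : ℕ)))).subset ?_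
    rintro (_ | ⟨i, p⟩) hp
    · exact Or.inl rfl
    · rcases lt_or_ge i cs.length with hi | hi
      · simp only [Pos, Set.mem_ofPred_eq, sub, children, List.getElem?_eq_getElem hi] at hp
        exact Or.inr (Set.mem_iUnion.2 ⟨⟨i, hi⟩, p, hp, rfl⟩)
      · simp [Pos, sub, children, List.getElem?_eq_none hi] at hp

theorem not_leftOf_nil_left (w : Node) : ¬ LeftOf [] w := by
  rintro ⟨q, i, j, u', w', -, h, -⟩
  simp at h

theorem not_leftOf_nil_right (u : Node) : ¬ LeftOf u [] := by
  rintro ⟨q, i, j, u', w', -, -, h⟩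
  simp at h

theorem leftOf_cons_cons {i j : ℕ} {u w : Node} :
    LeftOf (i :: u) (j :: w) ↔ i < j ∨ i = j ∧ LeftOf u w := by
  constructor
  · rintro ⟨_ | ⟨a, q⟩, i', j', u', w', hij, hu, hw⟩
    · simp_all
    · simp only [List.cons_append, List.cons.injEq] at hu hw
      exact Or.inr ⟨hu.1.trans hw.1.symm, q, i', j', u', w', hij, hu.2, hw.2⟩
  · rintro (h | ⟨rfl, q, i', j', u', w', hij, rfl, rfl⟩)
    · exact ⟨[], i, j, u, w, h, rfl, rfl⟩
    · exact ⟨i :: q, i', j', u', w', hij, rfl, rfl⟩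

theorem LeftOf.trans {u v w : Node} (huv : LeftOf u v) (hvw : LeftOf v w) : LeftOf u w := by
  induction u generalizing v w with
  | nil => exact absurd huv (not_leftOf_nil_left _)
  | cons i u ih =>
    cases v with
    | nil => exact absurd huv (not_leftOf_nil_right _)
    | cons j v =>
      cases w with
      | nil => exact absurd hvw (not_leftOf_nil_right _)
      | cons k w =>
        rw [leftOf_cons_cons] at *
        grind

instance : Trans LeftOf LeftOf LeftOf := ⟨LeftOf.trans⟩

theorem LeftOf.lt {u w : Node} (h : LeftOf u w) : u < w := by
  induction u generalizing w with
  | nil => exact absurd h (not_leftOf_nil_left _)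
  | cons i u ih =>
    cases w with
    | nil => exact absurd h (not_leftOf_nil_right _)
    | cons j w =>
      rw [leftOf_cons_cons] at h
      rw [List.cons_lt_cons_iff]
      exact h.imp_right fun h => ⟨h.1, ih h.2⟩

theorem leftOf_trichotomy (u w : Node) :
    LeftOf u w ∨ u <+: w ∨ w <+: u ∨ LeftOf w u := by
  induction u generalizing w with
  | nil => simp
  | cons i u ih =>
    cases w with
    | nil => simp
    | cons j w =>
      simp only [leftOf_cons_cons, List.cons_prefix_cons]
      have := ih w
      grind

theorem DeepSet.leftOf_iff_lt {X : Set Node} (hX : DeepSet X) {u w : Node} (hu : u ∈ X)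
    (hw : w ∈ X) : LeftOf u w ↔ u < w := by
  refine ⟨LeftOf.lt, fun h => ?_⟩
  rcases leftOf_trichotomy u w with h' | h' | h' | h'
  · exact h'
  · exact absurd ⟨h', h.ne⟩ (hX u hu w hw)
  · exact absurd ⟨h', h.ne'⟩ (hX w hw u hu)
  · exact absurd h'.lt h.asymm

theorem DeepSet.leftOrAbove_iff_le {X : Set Node} (hX : DeepSet X) {u w : Node} (hu : u ∈ X)
    (hw : w ∈ X) : LeftOrAbove u w ↔ u ≤ w := by
  rw [LeftOrAbove, hX.leftOf_iff_lt hu hw, le_iff_lt_or_eq]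
  refine or_congr_right ⟨?_, ?_⟩
  · rintro (h | h)
    · by_contra hne
      exact hX u hu w hw ⟨h, hne⟩
    · exact absurd h (hX w hw u hu)
  · rintro rfl
    exact Or.inl (List.prefix_refl u)

/-- `u` and `w` are the endpoints of a tuple in `Φ(X_1, …, X_k)`. -/
def Spans (Xs : List (Set Node)) (u w : Node) : Prop :=
  ∃ xs, Phi Xs xs ∧ xs.head? = some u ∧ xs.getLast? = some w

theorem phi_append_singleton {Xs : List (Set Node)} {X : Set Node} {xs : List Node} :
    Phi (Xs ++ [X]) xs ↔
      ∃ ys y, xs = ys ++ [y] ∧ Phi Xs ys ∧ y ∈ X ∧ ∀ z ∈ ys.getLast?, LeftOf z y := by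
  have key : List.Forall₂ (fun x X => x ∈ X) xs (Xs ++ [X]) ↔
      ∃ ys y, xs = ys ++ [y] ∧ List.Forall₂ (fun x X => x ∈ X) ys Xs ∧ y ∈ X := by
    rw [← List.forall₂_reverse_iff, List.reverse_append, List.reverse_singleton,
      List.singleton_append, List.forall₂_cons_right_iff]
    constructor
    · rintro ⟨y, ys, hy, hys, h⟩
      refine ⟨ys.reverse, y, ?_, ?_, hy⟩
      · rw [← List.reverse_reverse xs, h, List.reverse_cons]
      · rwa [← List.forall₂_reverse_iff, List.reverse_reverse]
    · rintro ⟨ys, y, rfl, h, hy⟩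
      exact ⟨y, ys.reverse, hy, List.forall₂_reverse_iff.2 h, by simp⟩
  rw [Phi, key]
  constructor
  · rintro ⟨⟨ys, y, rfl, h, hy⟩, hc⟩
    have := List.isChain_append.1 hc
    exact ⟨ys, y, rfl, ⟨h, this.1⟩, hy, fun z hz => this.2.2 z hz y rfl⟩
  · rintro ⟨ys, y, rfl, ⟨h, hc⟩, hy, hz⟩
    refine ⟨⟨ys, y, rfl, h, hy⟩, List.isChain_append.2 ⟨hc, List.isChain_singleton _, ?_⟩⟩
    rintro z hz' _ ⟨⟩
    exact hz z hz'

theorem spans_append_singleton {Xs : List (Set Node)} (hXs : Xs ≠ []) {X : Set Node}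
    {u w : Node} :
    Spans (Xs ++ [X]) u w ↔ ∃ v, Spans Xs u v ∧ w ∈ X ∧ LeftOf v w := by
  constructor
  · rintro ⟨xs, h, hu, hw⟩
    obtain ⟨ys, y, rfl, hys, hy, hz⟩ := phi_append_singleton.1 h
    have hne : ys ≠ [] := by
      rintro rfl
      exact hXs (List.forall₂_nil_left_iff.1 hys.1)
    simp only [List.getLast?_append, List.getLast?_singleton, Option.some_or,
      Option.some.injEq] at hw
    subst hw
    have hlast := List.getLast?_eq_some_getLast hne
    exact ⟨_, ⟨ys, hys, by rwa [List.head?_append_of_ne_nil _ hne] at hu, hlast⟩, hy,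
      hz _ hlast⟩
  · rintro ⟨v, ⟨ys, hys, hu, hv⟩, hw, hvw⟩
    refine ⟨ys ++ [w], phi_append_singleton.2 ⟨ys, w, rfl, hys, hw, ?_⟩, ?_, by simp⟩
    · simpa [hv] using hvw
    · simp [hu]

theorem spans_singleton {X : Set Node} {u w : Node} : Spans [X] u w ↔ u ∈ X ∧ u = w := by
  constructor
  · rintro ⟨xs, ⟨h, -⟩, hu, hw⟩
    rw [List.forall₂_cons_right_iff] at h
    obtain ⟨x, ys, hx, h, rfl⟩ := h
    rw [List.forall₂_nil_right_iff] at h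
    subst h
    simp_all
  · rintro ⟨hu, rfl⟩
    exact ⟨[u], ⟨by simpa using hu, List.isChain_singleton _⟩, rfl, rfl⟩

theorem spans_pair {X Y : Set Node} {u w : Node} :
    Spans [X, Y] u w ↔ u ∈ X ∧ w ∈ Y ∧ LeftOf u w := by
  rw [← List.singleton_append, spans_append_singleton (List.cons_ne_nil _ _)]
  simp only [spans_singleton]
  grind

theorem Spans.left_mem {Xs : List (Set Node)} {u w : Node} (h : Spans Xs u w) (hXs : Xs ≠ []) :
    u ∈ Xs.head hXs := by
  obtain ⟨xs, ⟨h, -⟩, hu, -⟩ := h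
  cases h with
  | nil => simp at hu
  | cons h _ => simp_all

theorem Spans.right_mem {Xs : List (Set Node)} {u w : Node} (h : Spans Xs u w) (hXs : Xs ≠ []) :
    w ∈ Xs.getLast hXs := by
  obtain ⟨xs, hxs, -, hw⟩ := h
  rw [← List.dropLast_append_getLast hXs] at hxs
  obtain ⟨ys, y, rfl, -, hy, -⟩ := phi_append_singleton.1 hxs
  simp_all

theorem Spans.leftOf {Xs : List (Set Node)} {u w : Node} (h : Spans Xs u w)
    (hXs : 2 ≤ Xs.length) : LeftOf u w := by
  obtain ⟨xs, ⟨h, hc⟩, hu, hw⟩ := h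
  have hlen := h.length_eq
  match xs, hlen with
  | [], hlen => simp at hu
  | [x], hlen => simp at hlen; omega
  | x :: y :: ys, _ =>
    simp only [List.head?_cons, Option.some.injEq] at hu
    subst hu
    rw [List.getLast?_cons_cons] at hw
    exact List.rel_of_pairwise_cons (List.isChain_iff_pairwise.1 hc) (List.mem_of_getLast? hw)

theorem mem_mop_iff {Xs : List (Set Node)} (hlen : 2 ≤ Xs.length)
    (hdeep : ∀ X ∈ Xs, DeepSet X) {u w : Node} :
    (u, w) ∈ Mop Xs ↔ Spans Xs u w ∧
      ∀ u' w', Spans Xs u' w' → u ≤ u' → w' ≤ w → u' = u ∧ w' = w := by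
  have hne : Xs ≠ [] := by rintro rfl; simp at hlen
  refine and_congr_right fun (h : Spans Xs u w) => ?_
  have hA := hdeep _ (List.head_mem hne)
  have hB := hdeep _ (List.getLast_mem hne)
  constructor
  · intro hmin u' w' h' hu hw
    obtain ⟨xs, hxs, hxu, hxw⟩ := id h'
    by_contra hcon
    refine hmin ⟨xs, u', w', hxs, hxu, hxw, ?_⟩
    rw [hA.leftOf_iff_lt (h.left_mem hne) (h'.left_mem hne),
      hA.leftOrAbove_iff_le (h.left_mem hne) (h'.left_mem hne),
      hB.leftOf_iff_lt (h'.right_mem hne) (h.right_mem hne),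
      hB.leftOrAbove_iff_le (h'.right_mem hne) (h.right_mem hne)]
    have := h'.leftOf hlen
    rcases hu.eq_or_lt with hu' | hu'
    · refine Or.inr ⟨hu, this, lt_of_le_of_ne hw fun hw' => hcon ⟨hu'.symm, hw'⟩⟩
    · exact Or.inl ⟨hu', this, hw⟩
  · rintro hmin ⟨xs, u', w', hxs, hxu, hxw, hcon⟩
    have h' : Spans Xs u' w' := ⟨xs, hxs, hxu, hxw⟩
    rw [hA.leftOf_iff_lt (h.left_mem hne) (h'.left_mem hne),
      hA.leftOrAbove_iff_le (h.left_mem hne) (h'.left_mem hne),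
      hB.leftOf_iff_lt (h'.right_mem hne) (h.right_mem hne),
      hB.leftOrAbove_iff_le (h'.right_mem hne) (h.right_mem hne)] at hcon
    rcases hcon with ⟨hu, -, hw⟩ | ⟨hu, -, hw⟩
    · exact hu.ne' (hmin u' w' h' hu.le hw).1
    · exact hw.ne (hmin u' w' h' hu hw.le).2

theorem exists_mem_mop {Xs : List (Set Node)} (hlen : 2 ≤ Xs.length)
    (hdeep : ∀ X ∈ Xs, DeepSet X) (hfin : ∀ X ∈ Xs, X.Finite) {u w : Node}
    (h : Spans Xs u w) : ∃ u' w', (u', w') ∈ Mop Xs ∧ u ≤ u' ∧ w' ≤ w := by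
  have hne : Xs ≠ [] := by rintro rfl; simp at hlen
  let S : Set (Nodeᵒᵈ × Node) := {p | Spans Xs (OrderDual.ofDual p.1) p.2}
  have hS : S.Finite :=
    (Set.Finite.prod (hfin _ (List.head_mem hne)) (hfin _ (List.getLast_mem hne))).subset
      fun p (hp : Spans Xs _ _) => ⟨hp.left_mem hne, hp.right_mem hne⟩
  obtain ⟨⟨u', w'⟩, hle, hmem, hmin⟩ :=
    hS.exists_le_minimal (show (OrderDual.toDual u, w) ∈ S from h)
  refine ⟨OrderDual.ofDual u', w', (mem_mop_iff hlen hdeep).2 ⟨hmem, fun a b hab ha hb => ?_⟩,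
    hle.1, hle.2⟩
  have hge := @hmin (OrderDual.toDual a, b) hab ⟨ha, hb⟩
  exact ⟨le_antisymm hge.1 ha, le_antisymm hb hge.2⟩

/-- (Lemma 1) `mop` can be computed iteratively from the left:
for deep sets `X_1, …, X_k` with `k > 2`, `(x_1, x_k) ∈ mop(X_1, …, X_k)` iff there
is `x_{k-1}` with `(x_1, x_{k-1}) ∈ mop(X_1, …, X_{k-1})` and
`(x_{k-1}, x_k) ∈ mop(mop(X_1, …, X_{k-1})|₂, X_k)`. -/
theorem mop_iterative_right {α : Type} (T : OTree α)
    (Xs : List (Set Node)) (Xk : Set Node)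
    (hlen : 2 ≤ Xs.length)
    (hdeep : ∀ X ∈ Xs ++ [Xk], DeepSet X)
    (hsub : ∀ X ∈ Xs ++ [Xk], X ⊆ Pos T)
    (x1 xk : Node) :
    (x1, xk) ∈ Mop (Xs ++ [Xk]) ↔
      ∃ xk1 : Node, (x1, xk1) ∈ Mop Xs ∧
        (xk1, xk) ∈ Mop [Prod.snd '' Mop Xs, Xk] := by
  have hne : Xs ≠ [] := by rintro rfl; simp at hlen
  have hdeepXs : ∀ X ∈ Xs, DeepSet X := fun X hX => hdeep X (List.mem_append_left _ hX)
  have hfin : ∀ X ∈ Xs, X.Finite := fun X hX =>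
    (finite_pos T).subset (hsub X (List.mem_append_left _ hX))
  have hB := hdeepXs _ (List.getLast_mem hne)
  have hXk : DeepSet Xk := hdeep Xk (by simp)
  have hmop : ∀ {u w}, (u, w) ∈ Mop Xs ↔ Spans Xs u w ∧
      ∀ u' w', Spans Xs u' w' → u ≤ u' → w' ≤ w → u' = u ∧ w' = w :=
    mem_mop_iff hlen hdeepXs
  have hY : Prod.snd '' Mop Xs ⊆ Xs.getLast hne := by
    rintro _ ⟨⟨u, w⟩, h, rfl⟩
    exact (hmop.1 h).1.right_mem hne
  have hYdeep : ∀ X ∈ [Prod.snd '' Mop Xs, Xk], DeepSet X := by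
    simp only [List.mem_cons, List.not_mem_nil, or_false, forall_eq_or_imp, forall_eq]
    exact ⟨fun x hx y hy => hB x (hY hx) y (hY hy), hXk⟩
  have leftOf_of_le : ∀ {u v v' w}, Spans Xs u v → v' ∈ Xs.getLast hne → v' ≤ v →
      LeftOf v w → LeftOf v' w := by
    intro u v v' w h hv' hle hvw
    rcases hle.eq_or_lt with rfl | hlt
    · exact hvw
    · exact ((hB.leftOf_iff_lt hv' (h.right_mem hne)).2 hlt).trans hvw
  rw [mem_mop_iff (by simp; omega) hdeep]
  simp only [mem_mop_iff (Xs := [_, _]) le_rfl hYdeep, spans_pair,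
    spans_append_singleton hne]
  constructor
  · rintro ⟨⟨v, hv, hxk, hvxk⟩, hmin⟩
    obtain ⟨u, v', huv', hu, hv'⟩ := exists_mem_mop hlen hdeepXs hfin hv
    obtain ⟨hs, hs'⟩ := hmop.1 huv'
    have hv'xk := leftOf_of_le hv (hs.right_mem hne) hv' hvxk
    obtain rfl := (hmin u xk ⟨v', hs, hxk, hv'xk⟩ hu le_rfl).1
    refine ⟨v', huv', ⟨⟨_, huv', rfl⟩, hxk, hv'xk⟩, ?_⟩
    rintro _ w ⟨⟨⟨a, b⟩, hab, rfl⟩, hw, hbw⟩ hle hwle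
    obtain ⟨hab, habmin⟩ := hmop.1 hab
    rcases le_total a u with hau | hau
    · obtain ⟨rfl, rfl⟩ := habmin u v' hs hau hle
      exact ⟨rfl, (hmin _ w ⟨_, hab, hw, hbw⟩ le_rfl hwle).2⟩
    · obtain ⟨rfl, rfl⟩ := hmin a w ⟨b, hab, hw, hbw⟩ hau hwle
      exact ⟨(habmin _ _ hs le_rfl hle).2.symm, rfl⟩
  · rintro ⟨v, hv, ⟨-, hxk, hvxk⟩, hmin⟩
    obtain ⟨hs, hsmin⟩ := hmop.1 hv
    refine ⟨⟨v, hs, hxk, hvxk⟩, ?_⟩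
    rintro a w ⟨b, hab, hw, hbw⟩ ha hwle
    obtain ⟨a', b', hm, ha', hb'⟩ := exists_mem_mop hlen hdeepXs hfin hab
    have hs' := (hmop.1 hm).1
    have hb'w := leftOf_of_le hab (hs'.right_mem hne) hb' hbw
    have hvb' : v ≤ b' := by
      by_contra! h
      exact h.ne (hsmin a' b' hs' (ha.trans ha') h.le).2
    obtain ⟨rfl, rfl⟩ := hmin b' w ⟨⟨_, hm, rfl⟩, hw, hb'w⟩ hvb' hwle
    obtain ⟨rfl, -⟩ := hsmin a' b' hs' (ha.trans ha') le_rfl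
    exact ⟨le_antisymm ha' ha, rfl⟩

end OTree

end TreeIncl
end

section
/- Let v be a node of a tree P with exactly one child v_1, and let T be a tree. Then emb(P(v),T) = Deep({fl(parent(w), label(v)) : w ∈ emb(P(v_1),T)} ∖ {⊥}), where terms with parent(w) = ⊥ (w the root of T) or fl(parent(w), label(v)) = ⊥ are discarded. -/
namespace TreeIncl

namespace OTree

variable {α β : Type}

theorem length_le_sizeOf_of_mem_pos (p : Node) :
    ∀ t : OTree α, p ∈ Pos t → p.length ≤ sizeOf t := by
  induction p with
  | nil => intro t _; simp
  | cons i p ih =>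
    rintro ⟨b, cs⟩ h
    simp only [Pos, Set.mem_ofPred_eq, sub, children] at h
    cases hc : cs[i]? with
    | none => simp [hc] at h
    | some d =>
      rw [hc] at h
      have h₁ := ih d h
      have h₂ := List.sizeOf_lt_of_mem (List.mem_of_getElem? hc)
      simp only [List.length_cons, node.sizeOf_spec]
      omega

theorem SAnc.length_lt {u w : Node} (h : SAnc u w) : u.length < w.length :=
  lt_of_le_of_ne h.1.length_le fun e => h.2 (h.1.eq_of_length e)

theorem SAnc.trans_anc {u v w : Node} (h : SAnc u v) (h' : v <+: w) : SAnc u w := by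
  refine ⟨h.1.trans h', ?_⟩
  rintro rfl
  have := h.length_lt
  have := h'.length_le
  omega

theorem SAnc.ne_nil {u w : Node} (h : SAnc u w) : w ≠ [] := by
  rintro rfl
  simpa using h.length_lt

theorem SAnc.prefix_dropLast {u w : Node} (h : SAnc u w) : u <+: w.dropLast := by
  refine List.prefix_of_prefix_length_le h.1 (List.dropLast_prefix w) ?_
  have := h.length_lt
  simp only [List.length_dropLast]
  omega

theorem SAnc.of_prefix_dropLast {u w : Node} (hw : w ≠ []) (h : u <+: w.dropLast) :
    SAnc u w := by
  refine ⟨h.trans (List.dropLast_prefix w), ?_⟩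
  rintro rfl
  have := h.length_le
  have := List.length_pos_iff.mpr hw
  simp only [List.length_dropLast] at *
  omega

theorem sAnc_nil_cons (i : ℕ) (p : Node) : SAnc [] (i :: p) := ⟨List.nil_prefix, by simp⟩

theorem sAnc_cons_cons {i : ℕ} {p q : Node} : SAnc (i :: p) (i :: q) ↔ SAnc p q := by
  simp [SAnc, List.cons_prefix_cons]

theorem LeftOf.not_anc {u w : Node} (h : LeftOf u w) : ¬ u <+: w ∧ ¬ w <+: u := by
  obtain ⟨q, i, j, u', w', hij, rfl, rfl⟩ := h
  constructor <;> rw [List.prefix_append_right_inj, List.cons_prefix_cons] <;> omega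

theorem leftOf_cons_cons_s14 {i : ℕ} {p q : Node} : LeftOf (i :: p) (i :: q) ↔ LeftOf p q := by
  constructor
  · rintro ⟨r, k, l, u, w, hkl, h₁, h₂⟩
    cases r with
    | nil =>
      simp only [List.nil_append, List.cons.injEq] at h₁ h₂
      omega
    | cons m r =>
      simp only [List.cons_append, List.cons.injEq] at h₁ h₂
      exact ⟨r, k, l, u, w, hkl, h₁.2, h₂.2⟩
  · rintro ⟨r, k, l, u, w, hkl, rfl, rfl⟩
    exact ⟨i :: r, k, l, u, w, hkl, rfl, rfl⟩

/-- In a set of nodes of bounded depth, every element has a deep descendant. -/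
theorem exists_prefix_mem_deepOf {X : Set Node} {N : ℕ} (hX : ∀ x ∈ X, x.length ≤ N)
    {x : Node} (hx : x ∈ X) : ∃ y ∈ DeepOf X, x <+: y := by
  induction hk : N - x.length using Nat.strong_induction_on generalizing x with
  | _ k ih =>
    by_cases h : ∃ z ∈ X, SAnc x z
    · obtain ⟨z, hz, hxz⟩ := h
      have h₁ := hxz.length_lt
      have h₂ := hX z hz
      obtain ⟨y, hy, hzy⟩ := ih (N - z.length) (by omega) hz rfl
      exact ⟨y, hy, hxz.1.trans hzy⟩
    · exact ⟨x, ⟨hx, h⟩, List.prefix_rfl⟩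

/-- The root images of the embeddings of `P` in `T`. -/
def occurrences (P T : OTree α) : Set Node := {w | ∃ f, IsEmb P T f ∧ f [] = w}

theorem nil_mem_pos (t : OTree α) : [] ∈ Pos t := by simp [Pos, sub]

theorem emb_eq_deepOf_occurrences (P T : OTree α) : emb P T = DeepOf (occurrences P T) := by
  ext w
  constructor
  · rintro ⟨f, ⟨hf, hd⟩, rfl⟩
    refine ⟨⟨f, hf, rfl⟩, ?_⟩
    rintro ⟨_, ⟨g, hg, rfl⟩, h⟩
    exact hd ⟨g, hg, h⟩
  · rintro ⟨⟨f, hf, rfl⟩, hd⟩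
    exact ⟨f, ⟨hf, fun ⟨g, hg, h⟩ => hd ⟨_, ⟨g, hg, rfl⟩, h⟩⟩, rfl⟩

theorem length_le_of_mem_occurrences {P T : OTree α} {w : Node} (h : w ∈ occurrences P T) :
    w.length ≤ sizeOf T := by
  obtain ⟨f, hf, rfl⟩ := h
  exact length_le_sizeOf_of_mem_pos _ _ (hf.mem _ (nil_mem_pos P))

theorem mem_pos_unary {a : α} {c : OTree α} {p : Node} :
    p ∈ Pos (node a [c]) ↔ p = [] ∨ ∃ r ∈ Pos c, p = 0 :: r := by
  match p with
  | [] => simp [nil_mem_pos]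
  | 0 :: r => simp [Pos, sub, children]
  | (n + 1) :: r => simp [Pos, sub, children]

theorem labelAt_unary_cons (a : α) (c : OTree α) (p : Node) :
    labelAt (node a [c]) (0 :: p) = labelAt c p := by
  simp [labelAt, sub, children]

theorem IsEmb.root_anc {P T : OTree α} {f : Node → Node} (hf : IsEmb P T f) {p : Node}
    (hp : p ∈ Pos P) : f [] <+: f p := by
  cases p with
  | nil => exact List.prefix_rfl
  | cons i p => exact ((hf.anc _ (nil_mem_pos P) _ hp).1 (sAnc_nil_cons i p)).1

theorem mem_occurrences_unary {a : α} {c T : OTree α} {q : Node} :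
    q ∈ occurrences (node a [c]) T ↔
      labelAt T q = some a ∧ ∃ w ∈ occurrences c T, SAnc q w := by
  constructor
  · rintro ⟨f, hf, rfl⟩
    have hroot := nil_mem_pos (node a [c])
    have hcons : ∀ p ∈ Pos c, 0 :: p ∈ Pos (node a [c]) :=
      fun p hp => mem_pos_unary.2 (Or.inr ⟨p, hp, rfl⟩)
    refine ⟨by rw [hf.lab _ hroot]; simp [labelAt, sub, label], f [0],
      ⟨fun p => f (0 :: p), ?_, rfl⟩,
      (hf.anc _ hroot _ (hcons _ (nil_mem_pos c))).1 (sAnc_nil_cons 0 [])⟩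
    constructor
    · exact fun p hp => hf.mem _ (hcons p hp)
    · intro p hp r hr h
      simpa using hf.inj _ (hcons p hp) _ (hcons r hr) h
    · exact fun p hp => (hf.lab _ (hcons p hp)).trans (labelAt_unary_cons a c p)
    · exact fun p hp r hr => sAnc_cons_cons.symm.trans (hf.anc _ (hcons p hp) _ (hcons r hr))
    · exact fun p hp r hr => leftOf_cons_cons_s14.symm.trans (hf.ord _ (hcons p hp) _ (hcons r hr))
  · rintro ⟨hlab, _, ⟨f, hf, rfl⟩, hq⟩
    have hbelow : ∀ p ∈ Pos c, SAnc q (f p) := fun p hp => hq.trans_anc (hf.root_anc hp)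
    refine ⟨fun p => match p with
      | [] => q
      | _ :: r => f r, ?_, rfl⟩
    constructor
    · intro p hp
      rcases mem_pos_unary.1 hp with rfl | ⟨r, hr, rfl⟩
      · intro h
        simp [labelAt, h] at hlab
      · exact hf.mem r hr
    · intro p hp p' hp' h
      rcases mem_pos_unary.1 hp with rfl | ⟨r, hr, rfl⟩ <;>
        rcases mem_pos_unary.1 hp' with rfl | ⟨r', hr', rfl⟩
      · rfl
      · exact absurd h (hbelow r' hr').2
      · exact absurd h.symm (hbelow r hr).2
      · rw [hf.inj r hr r' hr' h]
    · intro p hp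
      rcases mem_pos_unary.1 hp with rfl | ⟨r, hr, rfl⟩
      · simpa [labelAt, sub, label] using hlab
      · exact (hf.lab r hr).trans (labelAt_unary_cons a c r).symm
    · intro p hp p' hp'
      rcases mem_pos_unary.1 hp with rfl | ⟨r, hr, rfl⟩ <;>
        rcases mem_pos_unary.1 hp' with rfl | ⟨r', hr', rfl⟩
      · exact iff_of_false (fun h => h.2 rfl) (fun h => h.2 rfl)
      · exact iff_of_true (sAnc_nil_cons 0 r') (hbelow r' hr')
      · exact iff_of_false (fun h => h.ne_nil rfl)
          (fun h => lt_asymm h.length_lt (hbelow r hr).length_lt)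
      · exact sAnc_cons_cons.trans (hf.anc r hr r' hr')
    · intro p hp p' hp'
      rcases mem_pos_unary.1 hp with rfl | ⟨r, hr, rfl⟩ <;>
        rcases mem_pos_unary.1 hp' with rfl | ⟨r', hr', rfl⟩
      · exact iff_of_false (fun h => h.not_anc.1 List.prefix_rfl)
          (fun h => h.not_anc.1 List.prefix_rfl)
      · exact iff_of_false (fun h => h.not_anc.1 List.nil_prefix)
          (fun h => h.not_anc.1 (hbelow r' hr').1)
      · exact iff_of_false (fun h => h.not_anc.2 List.nil_prefix)
          (fun h => h.not_anc.2 (hbelow r hr).1)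
      · exact leftOf_cons_cons_s14.trans (hf.ord r hr r' hr')

theorem exists_mem_emb_of_mem_occurrences_unary {a : α} {c T : OTree α} {q : Node}
    (h : q ∈ occurrences (node a [c]) T) : ∃ w ∈ emb c T, SAnc q w := by
  obtain ⟨-, w, hw, hqw⟩ := mem_occurrences_unary.1 h
  obtain ⟨y, hy, hwy⟩ :=
    exists_prefix_mem_deepOf (fun _ hx => length_le_of_mem_occurrences hx) hw
  exact ⟨y, emb_eq_deepOf_occurrences c T ▸ hy, hqw.trans_anc hwy⟩

theorem exists_flAt_of_anc {T : OTree α} {a : α} {z x : Node} (hzx : z <+: x)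
    (hz : labelAt T z = some a) : ∃ q, FlAt T x a q ∧ z <+: q := by
  obtain ⟨q, ⟨⟨hqx, hq⟩, hd⟩, hzq⟩ :=
    exists_prefix_mem_deepOf (X := {r | r <+: x ∧ labelAt T r = some a}) (N := x.length)
      (fun r hr => hr.1.length_le) ⟨hzx, hz⟩
  exact ⟨q, ⟨hqx, hq, fun r hqr hrx hr => hd ⟨r, ⟨hrx, hr⟩, hqr⟩⟩, hzq⟩

/-- For a node `v` of `P` with a single child `v_1`:
`emb(P(v),T) = Deep({fl(parent(w), label(v)) : w ∈ emb(P(v_1),T)} ∖ {⊥})`,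
discarding the terms where `parent(w)` or `fl(parent(w), label(v))` is `⊥`. -/
theorem emb_unary_case {α : Type} (P T : OTree α) (v : Node) (a : α)
    (c : OTree α) (hs : sub v P = some (OTree.node a [c])) :
    emb (OTree.node a [c]) T =
      DeepOf {q | ∃ w ∈ emb c T, w ≠ [] ∧ FlAt T w.dropLast a q} := by
  have hsub : {q | ∃ w ∈ emb c T, w ≠ [] ∧ FlAt T w.dropLast a q} ⊆
      occurrences (node a [c]) T := by
    rintro q ⟨w, hw, hne, hq, hlab, -⟩
    rw [emb_eq_deepOf_occurrences] at hw
    exact mem_occurrences_unary.2 ⟨hlab, w, hw.1, SAnc.of_prefix_dropLast hne hq⟩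
  rw [emb_eq_deepOf_occurrences (node a [c]) T]
  ext q
  constructor
  · rintro ⟨hq, hd⟩
    obtain ⟨w, hw, hqw⟩ := exists_mem_emb_of_mem_occurrences_unary hq
    have hwocc := hw
    rw [emb_eq_deepOf_occurrences] at hwocc
    refine ⟨⟨w, hw, hqw.ne_nil, hqw.prefix_dropLast, (mem_occurrences_unary.1 hq).1, ?_⟩,
      fun ⟨z, hz, hqz⟩ => hd ⟨z, hsub hz, hqz⟩⟩
    exact fun r hqr hr hlab => hd ⟨r, mem_occurrences_unary.2
      ⟨hlab, w, hwocc.1, SAnc.of_prefix_dropLast hqw.ne_nil hr⟩, hqr⟩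
  · rintro ⟨hq, hd⟩
    refine ⟨hsub hq, ?_⟩
    rintro ⟨z, hz, hqz⟩
    obtain ⟨w, hw, hzw⟩ := exists_mem_emb_of_mem_occurrences_unary hz
    obtain ⟨y, hy, hzy⟩ :=
      exists_flAt_of_anc hzw.prefix_dropLast (mem_occurrences_unary.1 hz).1
    exact hd ⟨y, ⟨w, hw, hzw.ne_nil, hy⟩, hqz.trans_anc hzy⟩

end OTree

end TreeIncl
end
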